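/- arXiv:2302.13736 — 4 statements merged into one kernel-verified Lean document; each statement's English description precedes it below -/
import Mathlib

section
/- Let a, b ∈ ℝ with a ≥ b, let z̲ ≤ z̄ be real numbers, and let f, g : ℝ → ℝ be differentiable. Suppose that for every z ∈ [z̲, z̄] one has a·g′(z) + f′(z) ≥ 0 and b·g′(z) + f′(z) ≥ 0. Then the minimum of the problem min a·x − b·y + f(z) subject to x − y = g(z), x ≥ 0, y ≥ 0, z̲ ≤ z ≤ z̄ is attained with z = z̲; precisely: for every (x, y, z) with x ≥ 0, y ≥ 0, x − y = g(z) and z̲ ≤ z ≤ z̄, there exist x′ ≥ 0 and y′ ≥ 0 with x′ − y′ = g(z̲) such that a·x′ − b·y′ + f(z̲) ≤ a·x − b·y + f(z). -/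
/-- Lemma A.1: under the derivative conditions, the minimum of
`a·x − b·y + f(z)` subject to `x − y = g(z)`, `x, y ≥ 0`, `z ∈ [z̲, z̄]`
is attained with `z = z̲`. -/
theorem stmt_0 (a b zlo zhi : ℝ) (hab : a ≥ b) (hz : zlo ≤ zhi)
    (f g : ℝ → ℝ) (hf : Differentiable ℝ f) (hg : Differentiable ℝ g)
    (hderiv : ∀ z ∈ Set.Icc zlo zhi,
      a * deriv g z + deriv f z ≥ 0 ∧ b * deriv g z + deriv f z ≥ 0) :
    ∀ x y z : ℝ, x ≥ 0 → y ≥ 0 → x - y = g z → z ∈ Set.Icc zlo zhi →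
      ∃ x' y' : ℝ, x' ≥ 0 ∧ y' ≥ 0 ∧ x' - y' = g zlo ∧
        a * x' - b * y' + f zlo ≤ a * x - b * y + f z := by
  intro x y z hx hy hxy hzm
  have key : ∀ c : ℝ, (∀ w ∈ Set.Icc zlo zhi, 0 ≤ c * deriv g w + deriv f w) →
      c * g zlo + f zlo ≤ c * g z + f z := by
    intro c hc
    have hd : ∀ w, HasDerivAt (fun w => c * g w + f w) (c * deriv g w + deriv f w) w :=
      fun w => ((hg w).hasDerivAt.const_mul c).add (hf w).hasDerivAt
    have hm : MonotoneOn (fun w => c * g w + f w) (Set.Icc zlo zhi) := by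
      apply monotoneOn_of_deriv_nonneg (convex_Icc zlo zhi)
      · exact fun w _ => (hd w).continuousAt.continuousWithinAt
      · exact fun w _ => (hd w).differentiableAt.differentiableWithinAt
      · intro w hw
        rw [(hd w).deriv]
        exact hc w (interior_subset hw)
    exact hm (Set.left_mem_Icc.mpr hz) hzm hzm.1
  have ha := key a (fun w hw => (hderiv w hw).1)
  have hb := key b (fun w hw => (hderiv w hw).2)
  rw [← hxy] at ha hb
  rcases le_total 0 (g zlo) with h | h
  · refine ⟨g zlo, 0, h, le_refl _, by ring, ?_⟩
    nlinarith [mul_nonneg (sub_nonneg.mpr hab) hy]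
  · refine ⟨0, -g zlo, le_refl _, by linarith, by ring, ?_⟩
    nlinarith [mul_nonneg (sub_nonneg.mpr hab) hx]
end

section
/- Let A, M, Q ≥ 0 be reals with Q ≥ A + M. Let q, a, m : ℕ → ℝ satisfy, for all t ≥ 1: q(t+1) = q(t) + a(t) − m(t), 0 ≤ a(t) ≤ A, 0 ≤ m(t) ≤ M, and the policy conditions: if q(t) < M then m(t) = 0, and if q(t) > Q − A then a(t) = 0. If 0 ≤ q(1) ≤ Q, then 0 ≤ q(t) ≤ Q for all t ≥ 1. -/
/-- Front-end queue invariance (Proposition 1, front-end part): under the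
online policy conditions, the queue stays in [0, Q]. -/
theorem stmt_8 (A M Q : ℝ) (hA : 0 ≤ A) (hM : 0 ≤ M) (hQ : 0 ≤ Q)
    (hcap : Q ≥ A + M) (q a m : ℕ → ℝ)
    (hrec : ∀ t, 1 ≤ t → q (t + 1) = q t + a t - m t)
    (ha : ∀ t, 1 ≤ t → 0 ≤ a t ∧ a t ≤ A)
    (hm : ∀ t, 1 ≤ t → 0 ≤ m t ∧ m t ≤ M)
    (hpol1 : ∀ t, 1 ≤ t → q t < M → m t = 0)
    (hpol2 : ∀ t, 1 ≤ t → q t > Q - A → a t = 0)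
    (hinit : 0 ≤ q 1 ∧ q 1 ≤ Q) :
    ∀ t, 1 ≤ t → 0 ≤ q t ∧ q t ≤ Q := by
  intro t ht
  induction t, ht using Nat.le_induction with
  | base => exact hinit
  | succ t ht ih =>
    obtain ⟨h0, h1⟩ := ih
    obtain ⟨ha0, ha1⟩ := ha t ht
    obtain ⟨hm0, hm1⟩ := hm t ht
    rw [hrec t ht]
    constructor
    · by_cases h : q t < M
      · have := hpol1 t ht h
        linarith
      · linarith
    · by_cases h : q t > Q - A
      · have := hpol2 t ht h
        linarith
      · linarith
end

section
/- Let ι be a finite index set, E ≥ 0, M : ι → ℝ with M(j) ≥ 0 for all j, and Q a real with Q ≥ E + Σ_{j ∈ ι} M(j). Let q, e : ℕ → ℝ and m : ι → ℕ → ℝ satisfy, for all t ≥ 1: q(t+1) = q(t) + Σ_{j ∈ ι} m(j)(t) − e(t), 0 ≤ e(t) ≤ E, 0 ≤ m(j)(t) ≤ M(j) for all j, and the policy conditions: if q(t) < E then e(t) = 0, and if q(t) > Q − Σ_{j ∈ ι} M(j) then m(j)(t) = 0 for all j. If 0 ≤ q(1) ≤ Q, then 0 ≤ q(t) ≤ Q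 for all t ≥ 1. -/
/-- Back-end queue invariance (Proposition 1, back-end part): under the
online policy conditions, the queue stays in [0, Q]. -/
theorem stmt_9 {ι : Type*} [Fintype ι] (E : ℝ) (hE : 0 ≤ E)
    (M : ι → ℝ) (hM : ∀ j, 0 ≤ M j) (Q : ℝ) (hcap : Q ≥ E + ∑ j, M j)
    (q e : ℕ → ℝ) (m : ι → ℕ → ℝ)
    (hrec : ∀ t, 1 ≤ t → q (t + 1) = q t + (∑ j, m j t) - e t)
    (he : ∀ t, 1 ≤ t → 0 ≤ e t ∧ e t ≤ E)
    (hm : ∀ j, ∀ t, 1 ≤ t → 0 ≤ m j t ∧ m j t ≤ M j)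
    (hpol1 : ∀ t, 1 ≤ t → q t < E → e t = 0)
    (hpol2 : ∀ t, 1 ≤ t → q t > Q - ∑ j, M j → ∀ j, m j t = 0)
    (hinit : 0 ≤ q 1 ∧ q 1 ≤ Q) :
    ∀ t, 1 ≤ t → 0 ≤ q t ∧ q t ≤ Q := by
  intro t ht
  induction t, ht using Nat.le_induction with
  | base => exact hinit
  | succ t ht ih =>
    obtain ⟨h0, h1⟩ := ih
    obtain ⟨he0, he1⟩ := he t ht
    have hs0 : 0 ≤ ∑ j, m j t := Finset.sum_nonneg fun j _ => (hm j t ht).1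
    have hs1 : ∑ j, m j t ≤ ∑ j, M j := Finset.sum_le_sum fun j _ => (hm j t ht).2
    rw [hrec t ht]
    constructor
    · rcases lt_or_ge (q t) E with h | h
      · rw [hpol1 t ht h]; linarith
      · linarith
    · rcases lt_or_ge (Q - ∑ j, M j) (q t) with h | h
      · have hz : ∑ j, m j t = 0 := Finset.sum_eq_zero fun j _ => hpol2 t ht h j
        linarith
      · linarith
end

section
/- Let η_c > 0, η_d > 0, C ≥ 0, D ≥ 0, and let B̲ ≤ B̄ be reals with B̄ − B̲ ≥ η_c·C + D/η_d. Let b, c, d : ℕ → ℝ satisfy, for all t ≥ 1: b(t+1) = b(t) + η_c·c(t) − d(t)/η_d, 0 ≤ c(t) ≤ C, 0 ≤ d(t) ≤ D, and the policy conditions: if b(t) < B̲ + D/η_d then d(t) = 0, and if b(t) > B̄ − η_c·C then c(t) = 0. If B̲ ≤ b(1) ≤ B̄, then B̲ ≤ b(t) ≤ B̄ for all t ≥ 1. -/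
/-- Battery energy invariance (Proposition 1, battery part): under the
online policy conditions, the battery level stays in [B̲, B̄]. -/
theorem stmt_10 (ηc ηd C D Blo Bhi : ℝ) (hηc : 0 < ηc) (hηd : 0 < ηd)
    (hC : 0 ≤ C) (hD : 0 ≤ D) (hB : Blo ≤ Bhi)
    (hcap : Bhi - Blo ≥ ηc * C + D / ηd)
    (b c d : ℕ → ℝ)
    (hrec : ∀ t, 1 ≤ t → b (t + 1) = b t + ηc * c t - d t / ηd)
    (hc : ∀ t, 1 ≤ t → 0 ≤ c t ∧ c t ≤ C)
    (hd : ∀ t, 1 ≤ t → 0 ≤ d t ∧ d t ≤ D)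
    (hpol1 : ∀ t, 1 ≤ t → b t < Blo + D / ηd → d t = 0)
    (hpol2 : ∀ t, 1 ≤ t → b t > Bhi - ηc * C → c t = 0)
    (hinit : Blo ≤ b 1 ∧ b 1 ≤ Bhi) :
    ∀ t, 1 ≤ t → Blo ≤ b t ∧ b t ≤ Bhi := by
  intro t ht
  induction t, ht using Nat.le_induction with
  | base => exact hinit
  | succ t ht ih =>
    obtain ⟨hlo, hhi⟩ := ih
    obtain ⟨hc0, hcC⟩ := hc t ht
    obtain ⟨hd0, hdD⟩ := hd t ht
    have h1 : 0 ≤ ηc * c t := mul_nonneg hηc.le hc0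
    have h2 : ηc * c t ≤ ηc * C := mul_le_mul_of_nonneg_left hcC hηc.le
    have h3 : 0 ≤ d t / ηd := div_nonneg hd0 hηd.le
    have h4 : d t / ηd ≤ D / ηd := div_le_div_of_nonneg_right hdD hηd.le
    rw [hrec t ht]
    constructor
    · by_cases h : b t < Blo + D / ηd
      · rw [hpol1 t ht h, zero_div]
        linarith
      · linarith
    · by_cases h : b t > Bhi - ηc * C
      · rw [hpol2 t ht h, mul_zero]
        linarith
      · linarith
end
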